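/- Let (b,c) be one of the pairs (3,-2), (5,-6), (7,-12), (17,-72), (9,-20), and let u be the associated Lucas sequence. If n ≥ 2, p ∈ {2, 3}, and y is an integer with u_n = y^p, then (b,c) = (9,-20), n = 2, and u_2 = 9. In other words, these Lucas sequences contain no nontrivial square or cube terms except u_2 = 9 in the sequence (9,-20). -/

import Mathlib

/-- The Lucas sequence associated to `(b, c)`:
`u 0 = 0`, `u 1 = 1`, `u (n+2) = b * u (n+1) + c * u n`. -/
def lucasU (b c : ℤ) : ℕ → ℤ
  | 0 => 0
  | 1 => 1
  | n + 2 => b * lucasU b c (n + 1) + c * lucasU b c n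

/-- The companion Lucas sequence associated to `(b, c)`:
`v 0 = 2`, `v 1 = b`, `v (n+2) = b * v (n+1) + c * v n`. -/
def lucasV (b c : ℤ) : ℕ → ℤ
  | 0 => 2
  | 1 => b
  | n + 2 => b * lucasV b c (n + 1) + c * lucasV b c n

open QuadraticAlgebra

lemma lucasU_eq_pow_sub_pow (a : ℤ) (n : ℕ) :
    lucasU (2 * a + 1) (-(a * (a + 1))) n = (a + 1) ^ n - a ^ n := by
  induction n using Nat.twoStepInduction with
  | zero => simp [lucasU]
  | one => simp [lucasU]
  | more n h₀ h₁ => rw [lucasU, h₀, h₁]; ring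

/-! ### Cubes when the exponent is a multiple of three -/

lemma pow_sub_pow_ne_cube_of_three_dvd {a b : ℤ} (hb : 0 < b) (hab : b < a) {n : ℕ}
    (hn : n ≠ 0) (h3 : 3 ∣ n) (y : ℤ) : a ^ n - b ^ n ≠ y ^ 3 := by
  intro h
  obtain ⟨k, rfl⟩ := h3
  have hlt : b ^ (3 * k) < a ^ (3 * k) := pow_lt_pow_left₀ hab hb.le hn
  have hy : y ≠ 0 := by rintro rfl; norm_num at h; linarith
  refine fermatLastTheoremFor_iff_int.mp fermatLastTheoremThree (b ^ k) y (a ^ k)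
    (pow_ne_zero _ hb.ne') hy (pow_ne_zero _ (hb.trans hab).ne') ?_
  rw [← h, ← pow_mul, ← pow_mul, mul_comm k 3]
  ring

lemma three_dvd_of_cube_mod_nine {g : ZMod 9} (hg6 : g ^ 6 = 1)
    (hg : ∀ r < 6, ∀ y : ZMod 9, -g ^ r = y ^ 3 → 3 ∣ r) {n : ℕ} {y : ZMod 9}
    (h : -g ^ n = y ^ 3) : 3 ∣ n := by
  have hmod : g ^ n = g ^ (n % 6) := by
    conv_lhs => rw [← Nat.div_add_mod n 6, pow_add, pow_mul, hg6, one_pow, one_mul]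
  rw [hmod] at h
  have := hg _ (Nat.mod_lt n (by norm_num)) y h
  omega

lemma three_pow_eq_zero_mod_nine {n : ℕ} (hn : 2 ≤ n) : (3 : ZMod 9) ^ n = 0 := by
  obtain ⟨k, rfl⟩ := Nat.exists_eq_add_of_le hn
  rw [pow_add, show (3 : ZMod 9) ^ 2 = 0 by decide, zero_mul]

lemma three_pow_sub_two_pow_ne_cube {n : ℕ} (hn : 2 ≤ n) (y : ℤ) : 3 ^ n - 2 ^ n ≠ y ^ 3 := by
  intro h
  refine pow_sub_pow_ne_cube_of_three_dvd (by norm_num) (by norm_num) (by omega) ?_ y h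
  have h9 := congrArg (Int.cast : ℤ → ZMod 9) h
  push_cast at h9
  rw [three_pow_eq_zero_mod_nine hn, zero_sub] at h9
  exact three_dvd_of_cube_mod_nine (by decide) (by decide) h9

lemma four_pow_sub_three_pow_ne_cube {n : ℕ} (hn : 2 ≤ n) (y : ℤ) : 4 ^ n - 3 ^ n ≠ y ^ 3 := by
  intro h
  refine pow_sub_pow_ne_cube_of_three_dvd (by norm_num) (by norm_num) (by omega) ?_ y h
  have h9 := congrArg (Int.cast : ℤ → ZMod 9) h
  push_cast at h9
  rw [three_pow_eq_zero_mod_nine hn, sub_zero] at h9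
  have h2 : -(2 : ZMod 9) ^ (2 * n) = (-y : ZMod 9) ^ 3 := by
    rw [pow_mul, show (2 : ZMod 9) ^ 2 = 4 by decide, h9]; ring
  have := three_dvd_of_cube_mod_nine (by decide) (by decide) h2
  omega

/-! ### Elementary factorizations -/

lemma two_pow_sub_one_ne_sq {n : ℕ} (hn : 2 ≤ n) (y : ℤ) : 2 ^ n - 1 ≠ y ^ 2 := by
  intro h
  obtain ⟨k, rfl⟩ := Nat.exists_eq_add_of_le hn
  have h4 := congrArg (Int.cast : ℤ → ZMod 4) h
  push_cast at h4
  rw [pow_add, show (2 : ZMod 4) ^ 2 = 0 by decide, zero_mul] at h4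
  generalize (y : ZMod 4) = z at h4
  revert z; decide

lemma two_pow_sub_one_ne_cube {n : ℕ} (hn : 2 ≤ n) (y : ℤ) : 2 ^ n - 1 ≠ y ^ 3 := by
  intro h
  have hpow : (4 : ℤ) ≤ 2 ^ n := by
    calc (4 : ℤ) = 2 ^ 2 := by norm_num
      _ ≤ 2 ^ n := pow_le_pow_right₀ (by norm_num) hn
  have hfac : (y ^ 2 - y + 1) * (y + 1) = 2 ^ n := by linear_combination -h
  have hodd : Odd (y ^ 2 - y + 1) := by
    have : Even (y * (y - 1)) := Int.even_mul_pred_self y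
    have := this.add_one
    rwa [show y * (y - 1) + 1 = y ^ 2 - y + 1 by ring] at this
  have hcop : IsCoprime (y ^ 2 - y + 1) (2 ^ n) :=
    IsCoprime.pow_right (Int.isCoprime_iff_gcd_eq_one.mpr
      (by rw [Int.gcd_comm]; exact Int.isCoprime_iff_gcd_eq_one.mp
            (Int.isCoprime_two_left.mpr hodd)))
  have hunit := hcop.isUnit_of_dvd' dvd_rfl ⟨_, hfac.symm⟩
  rcases Int.isUnit_iff.mp hunit with h1 | h1
  · have : y * (y - 1) = 0 := by linear_combination h1
    rcases mul_eq_zero.mp this with h0 | h0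
    · subst h0; norm_num at h; linarith
    · obtain rfl : y = 1 := by linarith
      norm_num at h; linarith
  · nlinarith [sq_nonneg (2 * y - 1)]

/-- A positive square differing from a smaller square by a prime power splits accordingly. -/
lemma exists_pow_add_pow_of_sq_add_prime_pow {q : ℕ} (hq : q.Prime) {s y : ℤ} (hs : 0 < s)
    {k : ℕ} (h : s ^ 2 - (q : ℤ) ^ k = y ^ 2) :
    ∃ i j, i ≤ j ∧ i + j = k ∧ 2 * s = (q : ℤ) ^ i + (q : ℤ) ^ j := by
  have hq0 : (0 : ℤ) < q := by exact_mod_cast hq.pos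
  have hq1 : (1 : ℤ) < q := by exact_mod_cast hq.one_lt
  have hk := pow_pos hq0 k
  have hy : |y| ^ 2 = y ^ 2 := sq_abs y
  have hlt : |y| < s := abs_lt_of_sq_lt_sq (by linarith) hs.le
  have hfac : (s - |y|) * (s + |y|) = (q : ℤ) ^ k := by linear_combination h - hy
  have h0 := abs_nonneg y
  obtain ⟨i, -, hi⟩ := (dvd_prime_pow (Nat.prime_iff_prime_int.mp hq) k).mp (Dvd.intro _ hfac)
  obtain ⟨j, -, hj⟩ := (dvd_prime_pow (Nat.prime_iff_prime_int.mp hq) k).mp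
    (Dvd.intro_left _ hfac)
  replace hi : s - |y| = (q : ℤ) ^ i :=
    Int.eq_of_associated_of_nonneg hi (by linarith) (pow_pos hq0 i).le
  replace hj : s + |y| = (q : ℤ) ^ j :=
    Int.eq_of_associated_of_nonneg hj (by linarith) (pow_pos hq0 j).le
  refine ⟨i, j, ?_, ?_, by linarith⟩
  · exact (pow_le_pow_iff_right₀ hq1).mp (by linarith)
  · rw [hi, hj, ← pow_add] at hfac
    exact pow_right_injective₀ hq0 hq1.ne' hfac

lemma exists_eq_one_add_two_pow {s y : ℤ} (hs : 0 < s) (hodd : Odd s) {k : ℕ} (hk : k ≠ 0)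
    (h : s ^ 2 - 2 ^ k = y ^ 2) : ∃ j, j + 2 = k ∧ s = 1 + 2 ^ j := by
  obtain ⟨i, j, hij, rfl, hsum⟩ :=
    exists_pow_add_pow_of_sq_add_prime_pow Nat.prime_two hs (by exact_mod_cast h)
  push_cast at hsum
  obtain ⟨t, ht⟩ := hodd
  rcases j with _ | j
  · omega
  rcases i with _ | _ | i
  · rw [pow_succ] at hsum; omega
  · exact ⟨j, by ring, by rw [pow_succ] at hsum; omega⟩
  · obtain ⟨j, rfl⟩ : ∃ l, j = l + 1 := ⟨j - 1, by omega⟩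
    simp only [pow_succ] at hsum
    omega

lemma three_pow_ne_one_add_four_pow (m l : ℕ) (hm : m ≠ 0) : (3 : ℤ) ^ m ≠ 1 + 4 ^ l := by
  intro h
  have h3 := congrArg (Int.cast : ℤ → ZMod 3) h
  push_cast at h3
  rw [show (3 : ZMod 3) = 0 by decide, show (4 : ZMod 3) = 1 by decide, zero_pow hm,
    one_pow] at h3
  exact absurd h3 (by decide)

lemma two_pow_eq_zero_mod_four {n : ℕ} (hn : 2 ≤ n) : (2 : ZMod 4) ^ n = 0 := by
  obtain ⟨k, rfl⟩ := Nat.exists_eq_add_of_le hn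
  rw [pow_add, show (2 : ZMod 4) ^ 2 = 0 by decide, zero_mul]

lemma even_of_three_pow_sq_mod_four {n : ℕ} {z : ZMod 4} (h : 3 ^ n = z ^ 2) : Even n := by
  by_contra hn
  obtain ⟨k, rfl⟩ := Nat.not_even_iff_odd.mp hn
  rw [pow_succ, pow_mul, show (3 : ZMod 4) ^ 2 = 1 by decide, one_pow] at h
  revert z; decide

lemma three_pow_sub_two_pow_ne_sq {n : ℕ} (hn : 2 ≤ n) (y : ℤ) : 3 ^ n - 2 ^ n ≠ y ^ 2 := by
  intro h
  have h4 := congrArg (Int.cast : ℤ → ZMod 4) h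
  push_cast at h4
  rw [two_pow_eq_zero_mod_four hn, sub_zero] at h4
  obtain ⟨m, rfl⟩ := (even_of_three_pow_sq_mod_four h4).two_dvd
  obtain ⟨j, hj, hs⟩ := exists_eq_one_add_two_pow (s := 3 ^ m) (k := 2 * m) (y := y)
    (by positivity) (Odd.pow (by decide)) (by omega) (by rw [← h]; ring)
  obtain rfl : j = 2 * (m - 1) := by omega
  exact three_pow_ne_one_add_four_pow m (m - 1) (by omega) (by rw [hs, pow_mul]; norm_num)

lemma nine_pow_sub_eight_pow_ne_sq {n : ℕ} (hn : 2 ≤ n) (y : ℤ) : 9 ^ n - 8 ^ n ≠ y ^ 2 := by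
  intro h
  obtain ⟨j, hj, hs⟩ := exists_eq_one_add_two_pow (s := 3 ^ n) (k := 3 * n) (y := y)
    (by positivity) (Odd.pow (by decide)) (by omega)
    (by rw [← h, ← pow_mul, mul_comm n 2, pow_mul, pow_mul]; norm_num)
  have h4 := congrArg (Int.cast : ℤ → ZMod 4) hs
  push_cast at h4
  rw [two_pow_eq_zero_mod_four (by omega), add_zero] at h4
  obtain ⟨m, rfl⟩ := (even_of_three_pow_sq_mod_four (z := 1) (by rw [h4, one_pow])).two_dvd
  obtain rfl : j = 2 * (3 * m - 1) := by omega
  exact three_pow_ne_one_add_four_pow (2 * m) (3 * m - 1) (by omega)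
    (by rw [hs, pow_mul]; norm_num)

lemma four_pow_sub_three_pow_ne_sq {n : ℕ} (hn : 2 ≤ n) (y : ℤ) : 4 ^ n - 3 ^ n ≠ y ^ 2 := by
  intro h
  obtain ⟨i, j, hij, rfl, hsum⟩ := exists_pow_add_pow_of_sq_add_prime_pow Nat.prime_three
    (s := 2 ^ n) (y := y) (k := n) (by positivity)
    (by rw [← h, ← pow_mul, mul_comm n 2, pow_mul]; norm_num)
  push_cast at hsum
  rcases Nat.eq_zero_or_pos i with rfl | hi
  · have h8 := congrArg (Int.cast : ℤ → ZMod 8) hsum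
    push_cast at h8
    obtain ⟨k, rfl⟩ : ∃ k, j = k + 2 := ⟨j - 2, by omega⟩
    have hz : (2 : ZMod 8) * 2 ^ (0 + (k + 2)) = 0 := by
      rw [show 0 + (k + 2) = 2 + k by ring, pow_add, ← mul_assoc,
        show (2 : ZMod 8) * 2 ^ 2 = 0 by decide, zero_mul]
    rw [hz] at h8
    rcases Nat.even_or_odd' (k + 2) with ⟨l, hl | hl⟩
    · rw [hl, pow_mul, show (3 : ZMod 8) ^ 2 = 1 by decide, one_pow] at h8
      exact absurd h8 (by decide)
    · rw [hl, pow_succ, pow_mul, show (3 : ZMod 8) ^ 2 = 1 by decide, one_pow] at h8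
      exact absurd h8 (by decide)
  · have hdvd : (3 : ℤ) ∣ 2 * 2 ^ (i + j) :=
      hsum ▸ dvd_add (dvd_pow_self 3 hi.ne') (dvd_pow_self 3 (by omega))
    rw [← pow_succ'] at hdvd
    have := Int.prime_three.dvd_of_dvd_pow hdvd
    omega

lemma eq_two_of_five_pow_sub_four_pow_eq_sq {n : ℕ} (hn : 2 ≤ n) {y : ℤ}
    (h : 5 ^ n - 4 ^ n = y ^ 2) : n = 2 := by
  have heven : Even n := by
    by_contra hn'
    obtain ⟨k, hk⟩ := Nat.not_even_iff_odd.mp hn'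
    have h8 := congrArg (Int.cast : ℤ → ZMod 8) h
    push_cast at h8
    obtain ⟨l, hl⟩ := Nat.exists_eq_add_of_le hn
    have h0 : (4 : ZMod 8) ^ n = 0 := by
      rw [hl, pow_add, show (4 : ZMod 8) ^ 2 = 0 by decide, zero_mul]
    rw [h0, hk, pow_succ, pow_mul, show (5 : ZMod 8) ^ 2 = 1 by decide, one_pow] at h8
    generalize (y : ZMod 8) = z at h8
    revert z; decide
  obtain ⟨m, rfl⟩ := heven.two_dvd
  obtain ⟨j, hj, hs⟩ := exists_eq_one_add_two_pow (s := 5 ^ m) (k := 4 * m) (y := y)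
    (by positivity) (Odd.pow (by decide)) (by omega)
    (by rw [← h, ← pow_mul, mul_comm m 2, pow_mul 2 4 m, pow_mul 4 2 m]; norm_num)
  obtain rfl : j = 2 * (2 * m - 1) := by omega
  by_contra hm
  have h3 := congrArg (Int.cast : ℤ → ZMod 3) hs
  have h8 := congrArg (Int.cast : ℤ → ZMod 8) hs
  push_cast at h3 h8
  have h0 : (2 : ZMod 8) ^ (2 * (2 * m - 1)) = 0 := by
    rw [show 2 * (2 * m - 1) = 3 + (4 * m - 5) by omega, pow_add,
      show (2 : ZMod 8) ^ 3 = 0 by decide, zero_mul]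
  rw [h0] at h8
  rw [pow_mul, show (2 : ZMod 3) ^ 2 = 1 by decide, one_pow] at h3
  rcases Nat.even_or_odd' m with ⟨l, hl | hl⟩
  · rw [hl, pow_mul, show (5 : ZMod 3) ^ 2 = 1 by decide, one_pow] at h3
    exact absurd h3 (by decide)
  · rw [hl, pow_succ, pow_mul, show (5 : ZMod 8) ^ 2 = 1 by decide, one_pow] at h8
    exact absurd h8 (by decide)

lemma nine_pow_sub_eight_pow_ne_cube {n : ℕ} (hn : 2 ≤ n) (y : ℤ) : 9 ^ n - 8 ^ n ≠ y ^ 3 := by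
  intro h
  obtain ⟨x, hx⟩ : ∃ x : ℤ, x = 2 ^ n := ⟨_, rfl⟩
  have hx3 : ¬ (3 : ℤ) ∣ x := by
    intro hd
    rw [hx] at hd
    have := Int.prime_three.dvd_of_dvd_pow hd
    omega
  have hx4 : 4 ≤ x := by
    rw [hx]
    calc (4 : ℤ) = 2 ^ 2 := by norm_num
      _ ≤ 2 ^ n := pow_le_pow_right₀ (by norm_num) hn
  have h8 : (8 : ℤ) ^ n = x ^ 3 := by
    rw [hx, ← pow_mul, mul_comm n 3, pow_mul]; norm_num
  have h9 : (9 : ℤ) ^ n = 3 ^ (2 * n) := by rw [pow_mul]; norm_num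
  rw [h8, h9] at h
  have hfac : (y ^ 2 - y * x + x ^ 2) * (y + x) = 3 ^ (2 * n) := by linear_combination -h
  have hy3 : ¬ (3 : ℤ) ∣ y := by
    intro hd
    have : (3 : ℤ) ∣ x ^ 3 := by
      rw [show x ^ 3 = 3 ^ (2 * n) - y ^ 3 by linear_combination -h]
      exact dvd_sub (dvd_pow_self 3 (by omega)) (dvd_pow hd (by norm_num))
    exact hx3 (Int.prime_three.dvd_of_dvd_pow this)
  have hge : 12 ≤ y ^ 2 - y * x + x ^ 2 := by nlinarith [sq_nonneg (2 * y - x)]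
  obtain ⟨i, -, hi⟩ := (dvd_prime_pow Int.prime_three _).mp (Dvd.intro _ hfac)
  replace hi := Int.eq_of_associated_of_nonneg hi (by linarith) (by positivity)
  rcases i with _ | _ | i
  · norm_num at hi; linarith
  · norm_num at hi; linarith
  · have h9d : (9 : ℤ) ∣ y ^ 2 - y * x + x ^ 2 := ⟨3 ^ i, by rw [hi]; ring⟩
    have hA : (3 : ℤ) ∣ (y + x) := by
      refine Int.prime_three.dvd_of_dvd_pow (n := 2) ?_
      rw [show (y + x) ^ 2 = (y ^ 2 - y * x + x ^ 2) + 3 * (y * x) by ring]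
      exact dvd_add (Dvd.dvd.trans (by norm_num) h9d) (dvd_mul_right _ _)
    have h9' : (3 : ℤ) * 3 ∣ 3 * (y * x) := by
      rw [show 3 * (y * x) = (y + x) ^ 2 - (y ^ 2 - y * x + x ^ 2) by ring]
      refine dvd_sub ?_ (by norm_num; exact h9d)
      rw [← sq]; exact pow_dvd_pow_of_dvd hA 2
    rcases Int.prime_three.dvd_or_dvd ((mul_dvd_mul_iff_left (by norm_num)).mp h9') with h | h
    · exact hy3 h
    · exact hx3 h

/-! ### The ring of golden integers -/

/-- The ring `ℤ[φ]` of integers of `ℚ(√5)`, where `φ² = 1 + φ`. -/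
abbrev GoldenInt : Type := QuadraticAlgebra ℤ 1 1

namespace GoldenInt

lemma sq_add_mul_sub_sq_eq_zero_iff {a b : ℤ} : a ^ 2 + a * b - b ^ 2 = 0 ↔ a = 0 ∧ b = 0 := by
  refine ⟨fun h ↦ ?_, by rintro ⟨rfl, rfl⟩; norm_num⟩
  have hsq : (2 * a + b) * (2 * a + b) = 5 * (b * b) := by linear_combination 4 * h
  have hb : b = 0 := by
    by_contra hb
    have hq : IsSquare (5 : ℚ) := ⟨(2 * a + b) / b, by
      have hb' : (b : ℚ) ≠ 0 := by exact_mod_cast hb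
      field_simp
      have := congrArg (Int.cast : ℤ → ℚ) hsq
      push_cast at this
      linear_combination -this⟩
    exact absurd (Rat.isSquare_natCast_iff.mp (by exact_mod_cast hq) : IsSquare 5)
      (by norm_num)
  subst hb
  exact ⟨by simpa using hsq, rfl⟩

lemma norm_eq (z : GoldenInt) : z.norm = z.re ^ 2 + z.re * z.im - z.im ^ 2 := by
  rw [norm_def]; ring

lemma norm_eq_zero_iff {z : GoldenInt} : z.norm = 0 ↔ z = 0 := by
  rw [norm_eq, sq_add_mul_sub_sq_eq_zero_iff, QuadraticAlgebra.ext_iff]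
  rfl

instance : NoZeroDivisors GoldenInt where
  eq_zero_or_eq_zero_of_mul_eq_zero {x y} h := by
    rw [← norm_eq_zero_iff, map_mul, mul_eq_zero] at h
    simpa only [norm_eq_zero_iff] using h

instance : IsDomain GoldenInt := NoZeroDivisors.to_isDomain _

lemma exists_two_mul_abs_sub_mul_le (p : ℤ) {N : ℤ} (hN : N ≠ 0) :
    ∃ k, 2 * |p - N * k| ≤ |N| := by
  have h0 := Int.emod_nonneg p hN
  have h1 := Int.emod_lt_abs p hN
  have h2 := Int.emod_add_mul_ediv p N
  rcases le_or_gt (2 * (p % N)) |N| with h | h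
  · refine ⟨p / N, ?_⟩
    rw [show p - N * (p / N) = p % N by linarith, abs_of_nonneg h0]
    exact h
  · refine ⟨p / N + N.sign, ?_⟩
    rw [show p - N * (p / N + N.sign) = p % N - |N| by
      rw [mul_add, Int.mul_sign_self, Int.natCast_natAbs]; linarith,
      abs_of_nonpos (by linarith)]
    linarith

lemma exists_norm_sub_mul_lt (x y : GoldenInt) (hy : y ≠ 0) :
    ∃ q, (x - y * q).norm.natAbs < y.norm.natAbs := by
  have hN : y.norm ≠ 0 := mt norm_eq_zero_iff.mp hy
  obtain ⟨k, hk⟩ := exists_two_mul_abs_sub_mul_le (x * star y).re hN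
  obtain ⟨l, hl⟩ := exists_two_mul_abs_sub_mul_le (x * star y).im hN
  set e := (x * star y).re - y.norm * k with he
  set f := (x * star y).im - y.norm * l with hf
  refine ⟨⟨k, l⟩, ?_⟩
  have hmul : (x - y * ⟨k, l⟩) * star y = ⟨e, f⟩ := by
    rw [sub_mul, show y * ⟨k, l⟩ * star y = y * star y * ⟨k, l⟩ by ring,
      ← algebraMap_norm_eq_mul_star, algebraMap_eq]
    ext
    · simp [he]
    · simp [hf]
  have hnorm : (x - y * ⟨k, l⟩).norm * y.norm = e ^ 2 + e * f - f ^ 2 := by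
    rw [← norm_star y, ← map_mul, hmul, norm_eq]
  have habs : |(x - y * ⟨k, l⟩).norm| * |y.norm| < |y.norm| * |y.norm| := by
    rw [← abs_mul, hnorm]
    have hpos : 0 < |y.norm| := abs_pos.mpr hN
    generalize |y.norm| = M at *
    have he' := abs_le.mp (show |2 * e| ≤ M by rwa [abs_mul, abs_two])
    have hf' := abs_le.mp (show |2 * f| ≤ M by rwa [abs_mul, abs_two])
    rw [abs_lt]
    constructor <;> nlinarith
  have := lt_of_mul_lt_mul_right habs (abs_nonneg _)
  zify
  exact this

noncomputable instance : EuclideanDomain GoldenInt where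
  quotient x y := open Classical in
    if hy : y = 0 then 0 else (exists_norm_sub_mul_lt x y hy).choose
  quotient_zero x := by simp
  remainder x y := open Classical in
    x - y * if hy : y = 0 then 0 else (exists_norm_sub_mul_lt x y hy).choose
  quotient_mul_add_remainder_eq x y := by ring
  r x y := x.norm.natAbs < y.norm.natAbs
  r_wellFounded := (measure fun z : GoldenInt ↦ z.norm.natAbs).wf
  remainder_lt x y hy := by
    simp only [dif_neg hy]
    exact (exists_norm_sub_mul_lt x y hy).choose_spec
  mul_left_not_lt x y hy := by
    rw [not_lt, map_mul, Int.natAbs_mul]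
    exact Nat.le_mul_of_pos_right _ (Int.natAbs_pos.mpr (mt norm_eq_zero_iff.mp hy))

/-- Membership in one of the three classes `1`, `φ`, `φ²` modulo cubes. -/
def IsCubeUpToOmega (z : GoldenInt) : Prop :=
  ∃ w : GoldenInt, z = w ^ 3 ∨ z = ω * w ^ 3 ∨ z = ω ^ 2 * w ^ 3

lemma omega_mul_omega_sub_one : (ω : GoldenInt) * (ω - 1) = 1 := by
  ext <;> simp

lemma IsCubeUpToOmega.neg {z : GoldenInt} : IsCubeUpToOmega z → IsCubeUpToOmega (-z) := by
  rintro ⟨w, rfl | rfl | rfl⟩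
  · exact ⟨-w, Or.inl (by ring)⟩
  · exact ⟨-w, Or.inr (Or.inl (by ring))⟩
  · exact ⟨-w, Or.inr (Or.inr (by ring))⟩

lemma IsCubeUpToOmega.omega_mul {z : GoldenInt} :
    IsCubeUpToOmega z → IsCubeUpToOmega (ω * z) := by
  rintro ⟨w, rfl | rfl | rfl⟩
  · exact ⟨w, Or.inr (Or.inl rfl)⟩
  · exact ⟨w, Or.inr (Or.inr (by ring))⟩
  · exact ⟨ω * w, Or.inl (by ring)⟩

lemma IsCubeUpToOmega.of_omega_mul {z : GoldenInt} (h : IsCubeUpToOmega (ω * z)) :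
    IsCubeUpToOmega z := by
  obtain ⟨w, hw⟩ := h.omega_mul.omega_mul
  have hz : z = (ω - 1) ^ 3 * (ω * (ω * (ω * z))) := by
    linear_combination -z * ((ω * (ω - 1)) ^ 2 + ω * (ω - 1) + 1) * omega_mul_omega_sub_one
  refine ⟨(ω - 1) * w, ?_⟩
  rcases hw with hw | hw | hw <;> rw [hz, hw]
  · exact Or.inl (by ring)
  · exact Or.inr (Or.inl (by ring))
  · exact Or.inr (Or.inr (by ring))

lemma isCubeUpToOmega_mk (N : ℕ) : ∀ a b : ℤ, a.natAbs + b.natAbs ≤ N →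
    |a ^ 2 + a * b - b ^ 2| = 1 → 0 ≤ b → IsCubeUpToOmega ⟨a, b⟩ := by
  induction N using Nat.strong_induction_on with
  | _ N ih =>
  intro a b hN hnorm hb
  have key (a' b' : ℤ) (hlt : a'.natAbs + b'.natAbs < a.natAbs + b.natAbs)
      (h : |a' ^ 2 + a' * b' - b' ^ 2| = 1) : IsCubeUpToOmega ⟨a', b'⟩ := by
    rcases le_total 0 b' with hb' | hb'
    · exact ih _ (hlt.trans_le hN) a' b' le_rfl h hb'
    · have := ih _ (hlt.trans_le hN) (-a') (-b') (by simp) (by rw [← h]; congr 1; ring)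
        (by linarith)
      simpa using this.neg
  have hn := abs_le.mp hnorm.le
  rcases lt_trichotomy a 0 with ha | rfl | ha
  · rcases hb.eq_or_lt with rfl | hb
    · have : a = -1 := by nlinarith
      subst this
      exact ⟨-1, Or.inl (by ext <;> simp [pow_succ])⟩
    · have hab : b ≤ -a := by
        by_contra! hlt
        nlinarith
      refine IsCubeUpToOmega.of_omega_mul ?_
      rw [omega_mul_mk]
      refine key _ _ (by omega) ?_
      refine Eq.trans ?_ hnorm
      rw [← abs_neg]; congr 1; ring
  · have : b = 1 := by
      rcases hb.eq_or_lt with rfl | hb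
      · simp at hnorm
      · nlinarith
    subst this
    exact ⟨1, Or.inr (Or.inl (by ext <;> simp))⟩
  · rcases hb.eq_or_lt with rfl | hb
    · have : a = 1 := by nlinarith
      subst this
      exact ⟨1, Or.inl (by ext <;> simp)⟩
    · have hab : a ≤ b := by
        by_contra! hlt
        nlinarith
      rw [show (⟨a, b⟩ : GoldenInt) = ω * ⟨b - a, a⟩ by rw [omega_mul_mk]; ext <;> simp]
      refine (key _ _ (by omega) ?_).omega_mul
      refine Eq.trans ?_ hnorm
      rw [← abs_neg]; congr 1; ring

lemma isCubeUpToOmega_of_isUnit {z : GoldenInt} (hz : IsUnit z) : IsCubeUpToOmega z := by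
  have hnorm : |z.re ^ 2 + z.re * z.im - z.im ^ 2| = 1 := by
    rw [← norm_eq]
    exact Int.isUnit_iff_abs_eq.mp (isUnit_iff_norm_isUnit.mp hz)
  rcases le_total 0 z.im with h | h
  · exact isCubeUpToOmega_mk _ z.re z.im le_rfl hnorm h
  · have := isCubeUpToOmega_mk _ (-z.re) (-z.im) le_rfl (Eq.trans (by congr 1; ring) hnorm)
      (by linarith)
    simpa using this.neg

lemma mk_pow_three (a b : ℤ) : (⟨a, b⟩ : GoldenInt) ^ 3 =
    ⟨a ^ 3 + 3 * a * b ^ 2 + b ^ 3, 3 * a ^ 2 * b + 3 * a * b ^ 2 + 2 * b ^ 3⟩ := by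
  ext <;> simp [pow_succ] <;> ring

/-- An element congruent to `1` modulo `2` whose norm is a cube, and which is coprime to its
conjugate, is a cube. -/
lemma exists_eq_pow_three {x : GoldenInt} (hre : Odd x.re) (him : Even x.im)
    (hcop : IsCoprime x (star x)) {y : ℤ} (hnorm : x.norm = y ^ 3) :
    ∃ w : GoldenInt, x = w ^ 3 := by
  have hmul : x * star x = (y : GoldenInt) ^ 3 := by
    rw [← algebraMap_norm_eq_mul_star, hnorm]
    simp
  obtain ⟨d, u, hu⟩ := exists_associated_pow_of_mul_eq_pow' hcop hmul
  obtain ⟨w, hw⟩ := isCubeUpToOmega_of_isUnit u.isUnit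
  obtain ⟨a, b, hab⟩ : ∃ a b : ℤ, d * w = ⟨a, b⟩ := ⟨_, _, rfl⟩
  have heven : Even (3 * a ^ 2 * b + 3 * a * b ^ 2 + 2 * b ^ 3) := by
    rcases Int.even_or_odd a with ha | ha <;> rcases Int.even_or_odd b with hb | hb <;>
      simp [ha, hb, parity_simps]
  rcases hw with hw | hw | hw
  · exact ⟨d * w, by rw [← hu, hw, mul_pow]⟩
  · exfalso
    have hx : x = ω * (d * w) ^ 3 := by rw [← hu, hw]; ring
    rw [hab, mk_pow_three, omega_mul_mk] at hx
    rw [hx] at hre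
    simp only [one_mul] at hre
    exact (Int.not_even_iff_odd.mpr hre) heven
  · exfalso
    have hx : x = ω * (ω * (d * w) ^ 3) := by rw [← hu, hw]; ring
    rw [hab, mk_pow_three, omega_mul_mk, omega_mul_mk] at hx
    rw [hx] at hre him
    simp only [one_mul] at hre him
    exact Int.not_even_iff_odd.mpr hre ((Int.even_add.mp him).mp heven)

end GoldenInt

lemma five_pow_sub_four_pow_ne_cube_of_odd {m : ℕ} (hm : m ≠ 0) (y : ℤ) :
    5 ^ (2 * m + 1) - 4 ^ (2 * m + 1) ≠ y ^ 3 := by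
  intro h
  obtain ⟨s, hs⟩ : ∃ s : ℤ, s = 5 ^ m := ⟨_, rfl⟩
  obtain ⟨t, ht⟩ : ∃ t : ℤ, t = 2 ^ (2 * m + 1) := ⟨_, rfl⟩
  have hs_odd : Odd s := hs ▸ Odd.pow (by decide)
  have ht_even : Even t := ht ▸ (even_two.pow_of_ne_zero (by omega))
  have hst : 5 * s ^ 2 - t ^ 2 = y ^ 3 := by
    rw [← h, hs, ht, ← pow_mul 2, mul_comm _ 2, pow_mul 2 2, ← pow_mul, mul_comm m 2]
    norm_num
    ring
  have hy_odd : Odd (y ^ 3) := by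
    rw [← hst]
    exact (Odd.mul (by decide) hs_odd.pow).sub_even (ht_even.pow_of_ne_zero (by norm_num))
  set x : GoldenInt := ⟨t - s, 2 * s⟩ with hx
  have hnorm : x.norm = (-y) ^ 3 := by
    rw [GoldenInt.norm_eq, hx]
    linear_combination -hst
  have hcop : IsCoprime x (star x) := by
    have hint : IsCoprime (y ^ 3) (2 * t) := by
      rw [ht, ← pow_succ']
      exact ((Int.isCoprime_two_left.mpr hy_odd).symm).pow_right
    obtain ⟨c, d, hcd⟩ := hint
    have hprod : x * star x = -((y ^ 3 : ℤ) : GoldenInt) := by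
      rw [← algebraMap_norm_eq_mul_star, hnorm]
      ext <;> simp [Odd.neg_pow (show Odd 3 by decide)]
    have hsum : x + star x = ((2 * t : ℤ) : GoldenInt) := by
      ext <;> simp [hx]; ring
    have hone := congrArg (Int.cast : ℤ → GoldenInt) hcd
    rw [Int.cast_add, Int.cast_mul, Int.cast_mul, Int.cast_one, ← hsum] at hone
    exact ⟨-c * star x + d, d, by linear_combination hone - c * hprod⟩
  obtain ⟨w, hw⟩ := GoldenInt.exists_eq_pow_three (ht_even.sub_odd hs_odd)
    (even_two_mul s) hcop hnorm
  obtain ⟨a, b, rfl⟩ : ∃ a b : ℤ, w = ⟨a, b⟩ := ⟨_, _, rfl⟩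
  rw [GoldenInt.mk_pow_three, hx, QuadraticAlgebra.mk.injEq] at hw
  obtain ⟨hre, him⟩ := hw
  have hS : b * (3 * a ^ 2 + 3 * a * b + 2 * b ^ 2) = 2 * s := by linear_combination -him
  have hT : (2 * a + b) * ((2 * a + b) ^ 2 + 15 * b ^ 2) = 8 * t := by
    linear_combination -8 * hre - 4 * him
  have hp5 : Prime (5 : ℤ) := by norm_num
  have h5s : (5 : ℤ) ∣ s := hs ▸ dvd_pow_self 5 hm
  have h5u : ¬ (5 : ℤ) ∣ 2 * a + b := by
    intro hd
    have hd' := hT ▸ hd.mul_right ((2 * a + b) ^ 2 + 15 * b ^ 2)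
    rw [ht, show (8 : ℤ) = 2 ^ 3 by norm_num, ← pow_add] at hd'
    have := hp5.dvd_of_dvd_pow hd'
    omega
  have h5K : ¬ (5 : ℤ) ∣ 3 * a ^ 2 + 3 * a * b + 2 * b ^ 2 := by
    intro hd
    have hd' : (5 : ℤ) ∣ 3 * (2 * a + b) ^ 2 := by
      rw [show 3 * (2 * a + b) ^ 2 = 4 * (3 * a ^ 2 + 3 * a * b + 2 * b ^ 2) - 5 * b ^ 2 by ring]
      exact dvd_sub (hd.mul_left 4) (dvd_mul_right _ _)
    rcases hp5.dvd_or_dvd hd' with h | h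
    · omega
    · exact h5u (hp5.dvd_of_dvd_pow h)
  have h5b : (5 : ℤ) ∣ b :=
    (hp5.dvd_or_dvd (hS ▸ h5s.mul_left 2)).resolve_right h5K
  have hK2 : 3 * a ^ 2 + 3 * a * b + 2 * b ^ 2 ∣ 2 := by
    have hc : IsCoprime (3 * a ^ 2 + 3 * a * b + 2 * b ^ 2) ((5 : ℤ) ^ m) :=
      (((Prime.coprime_iff_not_dvd hp5).mpr h5K).symm).pow_right
    refine hc.dvd_of_dvd_mul_right (hs ▸ hS ▸ dvd_mul_left _ _)
  have hb0 : b ≠ 0 := by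
    rintro rfl
    rw [zero_mul] at hS
    have : 0 < s := hs ▸ by positivity
    linarith
  have hK_le := Int.le_of_dvd (by norm_num) hK2
  obtain ⟨c, rfl⟩ := h5b
  have hc : 1 ≤ c ^ 2 := by
    have : c ≠ 0 := by rintro rfl; simp at hb0
    have := sq_pos_of_ne_zero this
    linarith
  nlinarith [sq_nonneg (2 * a + 5 * c)]

lemma five_pow_sub_four_pow_ne_cube {n : ℕ} (hn : 2 ≤ n) (y : ℤ) : 5 ^ n - 4 ^ n ≠ y ^ 3 := by
  intro h
  rcases Nat.even_or_odd' n with ⟨m, rfl | rfl⟩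
  · refine pow_sub_pow_ne_cube_of_three_dvd (by norm_num) (by norm_num) (by omega) ?_ y h
    have h7 := congrArg (Int.cast : ℤ → ZMod 7) h
    push_cast at h7
    rw [pow_mul, pow_mul, show (5 : ZMod 7) ^ 2 = 4 by decide,
      show (4 : ZMod 7) ^ 2 = 2 by decide, ← Nat.div_add_mod m 3, pow_add, pow_add, pow_mul,
      pow_mul, show (4 : ZMod 7) ^ 3 = 1 by decide, show (2 : ZMod 7) ^ 3 = 1 by decide,
      one_pow, one_mul, one_mul] at h7
    have key : ∀ r < 3, ∀ z : ZMod 7, 4 ^ r - 2 ^ r = z ^ 3 → r = 0 := by decide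
    have := key _ (Nat.mod_lt m (by norm_num)) _ h7
    omega
  · exact five_pow_sub_four_pow_ne_cube_of_odd (by omega) y h

/-- For `(b,c) ∈ {(3,-2), (5,-6), (7,-12), (17,-72), (9,-20)}`, the Lucas sequence `u`
has no nontrivial square or cube terms except `u 2 = 9` in the sequence `(9,-20)`. -/
theorem no_nontrivial_squares_or_cubes_in_special_lucas_sequences
    (b c : ℤ)
    (hbc : (b, c) = (3, -2) ∨ (b, c) = (5, -6) ∨ (b, c) = (7, -12) ∨
      (b, c) = (17, -72) ∨ (b, c) = (9, -20))
    (n : ℕ) (hn : 2 ≤ n) (p : ℕ) (hp : p = 2 ∨ p = 3) (y : ℤ)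
    (h : lucasU b c n = y ^ p) :
    (b, c) = (9, -20) ∧ n = 2 ∧ lucasU b c n = 9 := by
  simp only [Prod.mk.injEq] at hbc ⊢
  rcases hbc with ⟨rfl, rfl⟩ | ⟨rfl, rfl⟩ | ⟨rfl, rfl⟩ | ⟨rfl, rfl⟩ | ⟨rfl, rfl⟩
  · rw [show (3 : ℤ) = 2 * 1 + 1 by norm_num, show (-2 : ℤ) = -(1 * (1 + 1)) by norm_num,
      lucasU_eq_pow_sub_pow, one_pow] at h
    rcases hp with rfl | rfl
    · exact absurd h (two_pow_sub_one_ne_sq hn y)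
    · exact absurd h (two_pow_sub_one_ne_cube hn y)
  · rw [show (5 : ℤ) = 2 * 2 + 1 by norm_num, show (-6 : ℤ) = -(2 * (2 + 1)) by norm_num,
      lucasU_eq_pow_sub_pow] at h
    rcases hp with rfl | rfl
    · exact absurd h (three_pow_sub_two_pow_ne_sq hn y)
    · exact absurd h (three_pow_sub_two_pow_ne_cube hn y)
  · rw [show (7 : ℤ) = 2 * 3 + 1 by norm_num, show (-12 : ℤ) = -(3 * (3 + 1)) by norm_num,
      lucasU_eq_pow_sub_pow] at h
    rcases hp with rfl | rfl
    · exact absurd h (four_pow_sub_three_pow_ne_sq hn y)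
    · exact absurd h (four_pow_sub_three_pow_ne_cube hn y)
  · rw [show (17 : ℤ) = 2 * 8 + 1 by norm_num, show (-72 : ℤ) = -(8 * (8 + 1)) by norm_num,
      lucasU_eq_pow_sub_pow] at h
    rcases hp with rfl | rfl
    · exact absurd h (nine_pow_sub_eight_pow_ne_sq hn y)
    · exact absurd h (nine_pow_sub_eight_pow_ne_cube hn y)
  · have hu := lucasU_eq_pow_sub_pow 4 n
    norm_num at hu
    rw [hu] at h ⊢
    rcases hp with rfl | rfl
    · obtain rfl := eq_two_of_five_pow_sub_four_pow_eq_sq hn h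
      norm_num
    · exact absurd h (five_pow_sub_four_pow_ne_cube hn y)
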